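/- arXiv:1204.6075 — 7 statements merged into one kernel-verified Lean document; each statement's English description precedes it below -/
import Mathlib

section
/- A loop Q with two-sided inverses satisfies the weak commutative inverse property (WCIP), i.e., (x·y)⁻¹·y = x⁻¹ for all x, y ∈ Q, if and only if y⁻¹\x⁻¹ = x\y for all x, y ∈ Q. -/
/-- A loop: a quasigroup (with left division `ldiv` and right division `rdiv`)
with a two-sided identity element. -/
class NLoop (Q : Type*) extends Mul Q, One Q where
  /-- left division: `ldiv a b = a \ b` -/
  ldiv : Q → Q → Q
  /-- right division: `rdiv b a = b / a` -/
  rdiv : Q → Q → Q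
  mul_ldiv : ∀ a b : Q, a * ldiv a b = b
  ldiv_mul : ∀ a b : Q, ldiv a (a * b) = b
  rdiv_mul : ∀ a b : Q, rdiv a b * b = a
  mul_rdiv : ∀ a b : Q, rdiv (a * b) b = a
  one_mul : ∀ a : Q, 1 * a = a
  mul_one : ∀ a : Q, a * 1 = a

/-- A loop with two-sided inverses. -/
class NInvLoop (Q : Type*) extends NLoop Q, Inv Q where
  mul_inv : ∀ a : Q, a * a⁻¹ = 1
  inv_mul : ∀ a : Q, a⁻¹ * a = 1

/-- `(α, β, γ)` is an autotopism: `xα · yβ = (x·y)γ`. -/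
def IsAutotopism {Q : Type*} [NLoop Q] (α β γ : Q → Q) : Prop :=
  ∀ x y : Q, α x * β y = γ (x * y)

/-- `σ` is an automorphism. -/
def IsAutomorphism {Q : Type*} [NLoop Q] (σ : Q → Q) : Prop :=
  ∀ x y : Q, σ (x * y) = σ x * σ y

/-- `β` is a left pseudoautomorphism with companion `a`. -/
def IsLeftPseudo {Q : Type*} [NLoop Q] (β : Q → Q) (a : Q) : Prop :=
  ∀ x y : Q, a * β (x * y) = (a * β x) * β y

/-- `γ` is a middle pseudoautomorphism with companion `c`. -/
def IsMiddlePseudo {Q : Type*} [NLoop Q] (γ : Q → Q) (c : Q) : Prop :=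
  ∀ x y : Q, γ (x * y) = NLoop.rdiv (γ x) (NLoop.ldiv c 1) * NLoop.ldiv c (γ y)

/-- `α` is a right pseudoautomorphism with companion `b`. -/
def IsRightPseudo {Q : Type*} [NLoop Q] (α : Q → Q) (b : Q) : Prop :=
  ∀ x y : Q, α (x * y) * b = α x * (α y * b)

/-- A loop with two-sided inverses satisfies the WCIP
`(x·y)⁻¹·y = x⁻¹` iff `y⁻¹ \ x⁻¹ = x \ y` for all `x, y`. -/
theorem stmt_7 (Q : Type*) [NInvLoop Q] :
    (∀ x y : Q, (x * y)⁻¹ * y = x⁻¹) ↔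
      (∀ x y : Q, NLoop.ldiv y⁻¹ x⁻¹ = NLoop.ldiv x y) := by
  constructor
  · intro h x y
    have hx := h x (NLoop.ldiv x y)
    rw [NLoop.mul_ldiv] at hx
    rw [← hx, NLoop.ldiv_mul]
  · intro h x y
    have hy := h x (x * y)
    rw [NLoop.ldiv_mul] at hy
    have hmul := NLoop.mul_ldiv (x * y)⁻¹ x⁻¹
    rwa [hy] at hmul
end

section
/- A loop Q with two-sided inverses satisfies the WCIP if and only if the binary operation x ∘ y = x⁻¹\y on Q is commutative. -/
theorem NInvLoop.inv_inv {Q : Type*} [NInvLoop Q] (x : Q) : x⁻¹⁻¹ = x := by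
  rw [← NLoop.ldiv_mul x⁻¹ x⁻¹⁻¹, NInvLoop.mul_inv, ← NInvLoop.inv_mul x, NLoop.ldiv_mul]

/-- A loop with two-sided inverses satisfies the WCIP iff the
operation `x ∘ y = x⁻¹ \ y` is commutative. -/
theorem stmt_8 (Q : Type*) [NInvLoop Q] :
    (∀ x y : Q, (x * y)⁻¹ * y = x⁻¹) ↔
      (∀ x y : Q, NLoop.ldiv x⁻¹ y = NLoop.ldiv y⁻¹ x) := by
  constructor
  · intro h x y
    have hx := h x⁻¹ (NLoop.ldiv x⁻¹ y)
    rw [NLoop.mul_ldiv, NInvLoop.inv_inv] at hx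
    rw [← NLoop.ldiv_mul y⁻¹ (NLoop.ldiv x⁻¹ y), hx]
  · intro h x y
    have hy := h x⁻¹ (x * y)
    rw [NInvLoop.inv_inv, NLoop.ldiv_mul] at hy
    calc (x * y)⁻¹ * y = (x * y)⁻¹ * NLoop.ldiv (x * y)⁻¹ x⁻¹ := congrArg _ hy
      _ = x⁻¹ := NLoop.mul_ldiv _ _
end

section
/- In a loop with two-sided inverses, any two of the following three properties imply the third: the right inverse property (RIP): (x·y)·y⁻¹ = x for all x, y; the automorphic inverse property (AIP): (x·y)⁻¹ = x⁻¹·y⁻¹ for all x, y; and the weak commutative inverse property (WCIP): (x·y)⁻¹·y = x⁻¹ for all x, y. -/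
/-- In a loop with two-sided inverses, any two of RIP, AIP, WCIP
imply the third. -/
theorem stmt_9 (Q : Type*) [NInvLoop Q] :
    ((∀ x y : Q, (x * y) * y⁻¹ = x) → (∀ x y : Q, (x * y)⁻¹ = x⁻¹ * y⁻¹) →
      (∀ x y : Q, (x * y)⁻¹ * y = x⁻¹)) ∧
    ((∀ x y : Q, (x * y) * y⁻¹ = x) → (∀ x y : Q, (x * y)⁻¹ * y = x⁻¹) →
      (∀ x y : Q, (x * y)⁻¹ = x⁻¹ * y⁻¹)) ∧
    ((∀ x y : Q, (x * y)⁻¹ = x⁻¹ * y⁻¹) → (∀ x y : Q, (x * y)⁻¹ * y = x⁻¹) →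
      (∀ x y : Q, (x * y) * y⁻¹ = x)) := by
  have hinv (x : Q) : x⁻¹⁻¹ = x := by
    rw [← NLoop.ldiv_mul x⁻¹ x⁻¹⁻¹, NInvLoop.mul_inv, ← NInvLoop.inv_mul x, NLoop.ldiv_mul]
  refine ⟨fun rip aip x y => ?_, fun rip wcip x y => ?_, fun aip wcip x y => ?_⟩
  · simpa only [aip, hinv] using rip x⁻¹ y⁻¹
  · simpa only [wcip] using (rip (x * y)⁻¹ y).symm
  · simpa only [aip, hinv] using wcip x⁻¹ y⁻¹
end

section
/- Let Q be a loop with two-sided inverses satisfying the WCIP, and let J denote the inversion map x ↦ x⁻¹. If (α, β, γ) is an autotopism of Q, then (JγJ, β, JαJ) is an autotopism of Q. -/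
/-- In a WCIP loop with two-sided inverses, if `(α, β, γ)` is an
autotopism then so is `(JγJ, β, JαJ)`, where `J : x ↦ x⁻¹`. -/
theorem stmt_10 (Q : Type*) [NInvLoop Q]
    (wcip : ∀ x y : Q, (x * y)⁻¹ * y = x⁻¹)
    (α β γ : Equiv.Perm Q) (h : IsAutotopism (⇑α) (⇑β) (⇑γ)) :
    IsAutotopism (fun x : Q => (γ x⁻¹)⁻¹) (⇑β) (fun x : Q => (α x⁻¹)⁻¹) := by
  intro x y
  have hγ : γ x⁻¹ = α (x * y)⁻¹ * β y := by rw [h, wcip]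
  simp only [hγ, wcip]
end

section
/- Let Q be a loop with two-sided inverses satisfying the WCIP, let σ be a permutation of Q, and let J denote the inversion map x ↦ x⁻¹. Then σ is a middle pseudoautomorphism of Q with companion c if and only if JσJ is a right pseudoautomorphism of Q with companion c⁻¹. -/
namespace NLoop

variable {Q : Type*} [NLoop Q]

theorem eq_ldiv {a b x : Q} (h : a * x = b) : x = ldiv a b := by
  rw [← h, ldiv_mul]

theorem eq_rdiv {a b x : Q} (h : x * a = b) : x = rdiv b a := by
  rw [← h, mul_rdiv]

theorem mul_left_cancel {a x y : Q} (h : a * x = a * y) : x = y := by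
  rw [← ldiv_mul a x, h, ldiv_mul]

end NLoop

namespace NInvLoop

open NLoop

variable {Q : Type*} [NInvLoop Q]

theorem inv_inv_s11 (a : Q) : a⁻¹⁻¹ = a :=
  NLoop.mul_left_cancel ((NInvLoop.mul_inv a⁻¹).trans (NInvLoop.inv_mul a).symm)

theorem inv_one : (1 : Q)⁻¹ = 1 := by
  rw [← NLoop.one_mul (1 : Q)⁻¹, NInvLoop.mul_inv]

theorem ldiv_one (a : Q) : ldiv a 1 = a⁻¹ :=
  (eq_ldiv (NInvLoop.mul_inv a)).symm

/-- Conjugating by inversion and swapping the outer components preserves autotopisms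
of a WCIP loop. -/
theorem isAutotopism_inv_conj (wcip : ∀ x y : Q, (x * y)⁻¹ * y = x⁻¹) {α β γ : Q → Q}
    (h : IsAutotopism α β γ) :
    IsAutotopism (fun x => (γ x⁻¹)⁻¹) β (fun x => (α x⁻¹)⁻¹) := by
  intro x y
  have hx : (x * y)⁻¹ * y = x⁻¹ := wcip x y
  have h' := h (x * y)⁻¹ y
  rw [hx] at h'
  change (γ x⁻¹)⁻¹ * β y = (α (x * y)⁻¹)⁻¹
  rw [← h', wcip]

theorem inv_rdiv (wcip : ∀ x y : Q, (x * y)⁻¹ * y = x⁻¹) (x y : Q) :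
    (rdiv x y)⁻¹ = x⁻¹ * y := by
  rw [← wcip (rdiv x y) y, rdiv_mul]

end NInvLoop

/-- In a WCIP loop with two-sided inverses, a permutation `σ` is a
middle pseudoautomorphism with companion `c` iff `JσJ` is a right
pseudoautomorphism with companion `c⁻¹`, where `J : x ↦ x⁻¹`. -/
theorem stmt_11 (Q : Type*) [NInvLoop Q]
    (wcip : ∀ x y : Q, (x * y)⁻¹ * y = x⁻¹)
    (σ : Equiv.Perm Q) (c : Q) :
    IsMiddlePseudo (⇑σ) c ↔ IsRightPseudo (fun x : Q => (σ x⁻¹)⁻¹) c⁻¹ := by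
  open NLoop NInvLoop in
  constructor
  · intro h
    have hσ : σ 1 = 1 := by
      have h₁ := h 1 1
      rw [NLoop.mul_one, ldiv_one] at h₁
      have h₂ : ldiv c (σ 1) = c⁻¹ :=
        NLoop.mul_left_cancel (h₁.symm.trans (rdiv_mul (σ 1) c⁻¹).symm)
      rw [← mul_ldiv c (σ 1), h₂, NInvLoop.mul_inv]
    have key : ∀ x y, (σ x⁻¹)⁻¹ * ldiv c (σ y) = (σ (x * y)⁻¹)⁻¹ * c⁻¹ := by
      intro x y
      have ht : IsAutotopism (fun x => rdiv (σ x) c⁻¹) (fun y => ldiv c (σ y)) σ := by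
        intro x y
        rw [h x y, ldiv_one]
      rw [← inv_rdiv wcip (σ (x * y)⁻¹)]
      exact isAutotopism_inv_conj wcip ht x y
    intro x y
    have hy := key 1 y
    rw [NInvLoop.inv_one, hσ, NInvLoop.inv_one, NLoop.one_mul, NLoop.one_mul] at hy
    change (σ (x * y)⁻¹)⁻¹ * c⁻¹ = (σ x⁻¹)⁻¹ * ((σ y⁻¹)⁻¹ * c⁻¹)
    rw [← hy, key]
  · intro h
    have hσ : σ 1 = 1 := by
      have h₁ := h 1 1
      simp only [NLoop.one_mul, NInvLoop.inv_one] at h₁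
      have h₂ : (σ 1)⁻¹ = 1 := by
        rw [eq_rdiv h₁.symm, ← eq_rdiv (NLoop.one_mul _)]
      rw [← NInvLoop.inv_inv_s11 (σ 1), h₂, NInvLoop.inv_one]
    have key : ∀ x y, rdiv (σ x) c⁻¹ * ((σ y⁻¹)⁻¹ * c⁻¹) = σ (x * y) := by
      intro x y
      have ht : IsAutotopism (fun x => (σ x⁻¹)⁻¹) (fun y => (σ y⁻¹)⁻¹ * c⁻¹)
          (fun x => (σ x⁻¹)⁻¹ * c⁻¹) := fun x y => (h x y).symm
      have h₁ := isAutotopism_inv_conj wcip ht x y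
      simpa only [← inv_rdiv wcip, NInvLoop.inv_inv_s11] using h₁
    intro x y
    have hy := key 1 y
    rw [hσ, ← eq_rdiv (NInvLoop.mul_inv c), NLoop.one_mul] at hy
    rw [ldiv_one, ← eq_ldiv hy, key]
end

section
/- Let Q be a loop with two-sided inverses satisfying the WCIP, let σ be a permutation of Q, and let c ∈ Q. If σ is a right pseudoautomorphism of Q with companion c, then c lies in the left nucleus N_λ(Q). -/
theorem NLoop.mul_left_cancel_s14 {Q : Type*} [NLoop Q] {a x y : Q} (h : a * x = a * y) : x = y := by
  rw [← NLoop.ldiv_mul a x, h, NLoop.ldiv_mul]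

theorem NLoop.mul_right_cancel {Q : Type*} [NLoop Q] {a x y : Q} (h : x * a = y * a) : x = y := by
  rw [← NLoop.mul_rdiv x a, h, NLoop.mul_rdiv]

theorem NInvLoop.inv_one_s14 {Q : Type*} [NInvLoop Q] : (1 : Q)⁻¹ = 1 := by
  rw [← NLoop.one_mul (1 : Q)⁻¹, NInvLoop.mul_inv]

theorem IsRightPseudo.map_one {Q : Type*} [NLoop Q] {α : Q → Q} {b : Q}
    (h : IsRightPseudo α b) : α 1 = 1 := by
  have h1 := h 1 1
  rw [NLoop.mul_one] at h1
  exact NLoop.mul_right_cancel (a := α 1 * b) (h1.symm.trans (NLoop.one_mul _).symm)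

/-- If the inverse of `c` lies in the left nucleus, then so does `c`. -/
theorem NInvLoop.mem_left_nucleus_of_inv {Q : Type*} [NInvLoop Q] {c : Q}
    (h : ∀ x y : Q, (c⁻¹ * x) * y = c⁻¹ * (x * y)) (x y : Q) :
    (c * x) * y = c * (x * y) := by
  apply NLoop.mul_left_cancel_s14 (a := c⁻¹)
  rw [← h, ← h, ← h, NInvLoop.inv_mul, NLoop.one_mul, NLoop.one_mul]

/-- In a WCIP loop, reflecting the autotopism of a right pseudoautomorphism yields another
autotopism with the same second component. -/
theorem IsRightPseudo.wcip_reflect {Q : Type*} [NInvLoop Q]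
    (wcip : ∀ x y : Q, (x * y)⁻¹ * y = x⁻¹) {σ : Q → Q} {c : Q} (h : IsRightPseudo σ c) :
    IsAutotopism (fun w => (σ w⁻¹ * c)⁻¹) (fun y => σ y * c) (fun w => (σ w⁻¹)⁻¹) := by
  intro w y
  have hw : (w * y)⁻¹ * y = w⁻¹ := wcip w y
  change (σ w⁻¹ * c)⁻¹ * (σ y * c) = (σ (w * y)⁻¹)⁻¹
  rw [← hw, h, wcip]

/-- Theorem, part 1: In a WCIP loop with two-sided inverses, if a
permutation `σ` is a right pseudoautomorphism with companion `c`, then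
`c ∈ N_λ(Q)`. -/
theorem stmt_14 (Q : Type*) [NInvLoop Q]
    (wcip : ∀ x y : Q, (x * y)⁻¹ * y = x⁻¹)
    (σ : Equiv.Perm Q) (c : Q) (h : IsRightPseudo (⇑σ) c) :
    ∀ x y : Q, (c * x) * y = c * (x * y) := by
  have hT : ∀ w y, (σ w⁻¹ * c)⁻¹ * (σ y * c) = (σ (w * y)⁻¹)⁻¹ := h.wcip_reflect wcip
  have hU : ∀ y, (σ y⁻¹)⁻¹ = c⁻¹ * (σ y * c) := by
    intro y
    have := hT 1 y
    rw [NInvLoop.inv_one_s14, h.map_one, NLoop.one_mul, NLoop.one_mul] at this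
    exact this.symm
  have hmul : ∀ w v, (σ w⁻¹ * c)⁻¹ * v = c⁻¹ * (σ w * v) := by
    intro w v
    have hv : σ (σ.symm (NLoop.rdiv v c)) * c = v := by
      rw [Equiv.apply_symm_apply, NLoop.rdiv_mul]
    rw [← hv, hT, hU, h]
  refine NInvLoop.mem_left_nucleus_of_inv fun x y => ?_
  have h1 := hmul (σ.symm x) 1
  rw [NLoop.mul_one, NLoop.mul_one, Equiv.apply_symm_apply] at h1
  rw [← h1, hmul, Equiv.apply_symm_apply]
end

section
/- Let Q be a commutative loop with the inverse property (i.e., Q has two-sided inverses and x⁻¹·(x·y) = y and (y·x)·x⁻¹ = y for all x, y ∈ Q). Then every pseudoautomorphism of Q (left, middle, or right) is an automorphism. -/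
namespace NInvLoop

variable {Q : Type*} [NInvLoop Q]

theorem inv_inv_of_lip (lip : ∀ x y : Q, x⁻¹ * (x * y) = y) (x : Q) : x⁻¹⁻¹ = x := by
  have h := lip x⁻¹ x
  rwa [inv_mul, NLoop.mul_one] at h

theorem mul_inv_cancel_left_of_lip (lip : ∀ x y : Q, x⁻¹ * (x * y) = y) (x y : Q) :
    x * (x⁻¹ * y) = y := by
  simpa only [inv_inv_of_lip lip] using lip x⁻¹ y

theorem mul_left_cancel_of_lip (lip : ∀ x y : Q, x⁻¹ * (x * y) = y) {x y z : Q}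
    (h : x * y = x * z) : y = z := by
  rw [← lip x y, h, lip]

theorem eq_inv_of_mul_eq_one (lip : ∀ x y : Q, x⁻¹ * (x * y) = y) {x y : Q}
    (h : x * y = 1) : y = x⁻¹ :=
  mul_left_cancel_of_lip lip (h.trans (mul_inv x).symm)

/-- Inversion is an automorphism of a commutative inverse property loop. -/
theorem inv_mul_of_comm (comm : ∀ x y : Q, x * y = y * x)
    (lip : ∀ x y : Q, x⁻¹ * (x * y) = y) (x y : Q) : (x * y)⁻¹ = x⁻¹ * y⁻¹ := by
  have h : (x * y)⁻¹ * x = y⁻¹ := by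
    have k := lip (x * y) y⁻¹
    rwa [comm (x * y) y⁻¹, comm x y, lip, comm y x] at k
  rw [← h, comm (x * y)⁻¹ x, lip]

/-- In a commutative inverse property loop, an element of the middle nucleus lies in the
left nucleus. -/
theorem mul_assoc_of_middle (comm : ∀ x y : Q, x * y = y * x)
    (lip : ∀ x y : Q, x⁻¹ * (x * y) = y) {a : Q}
    (h : ∀ u v : Q, (a * u) * v = u * (a * v)) (s t : Q) : (a * s) * t = a * (s * t) := by
  have k := h (a * s)⁻¹ (a⁻¹ * ((a * s) * t))
  rw [mul_inv_cancel_left_of_lip lip, lip, inv_mul_of_comm comm lip,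
    mul_inv_cancel_left_of_lip lip] at k
  conv_rhs => rw [← k]
  rw [mul_inv_cancel_left_of_lip lip, mul_inv_cancel_left_of_lip lip]

end NInvLoop

section Pseudoautomorphisms

variable {Q : Type*} [NInvLoop Q]

theorem IsLeftPseudo.isAutomorphism (comm : ∀ x y : Q, x * y = y * x)
    (lip : ∀ x y : Q, x⁻¹ * (x * y) = y) {β : Q → Q} (hβ : Function.Surjective β) {a : Q}
    (h : IsLeftPseudo β a) : IsAutomorphism β := by
  have middle (u v : Q) : (a * u) * v = u * (a * v) := by
    obtain ⟨x, rfl⟩ := hβ u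
    obtain ⟨y, rfl⟩ := hβ v
    rw [← h, comm x y, h, comm]
  intro x y
  apply NInvLoop.mul_left_cancel_of_lip lip (x := a)
  rw [h, NInvLoop.mul_assoc_of_middle comm lip middle]

theorem IsRightPseudo.isLeftPseudo (comm : ∀ x y : Q, x * y = y * x) {α : Q → Q} {b : Q}
    (h : IsRightPseudo α b) : IsLeftPseudo α b := by
  intro x y
  rw [comm x y, comm, h, comm, comm b (α x)]

theorem IsMiddlePseudo.isLeftPseudo (comm : ∀ x y : Q, x * y = y * x)
    (lip : ∀ x y : Q, x⁻¹ * (x * y) = y) {γ : Q → Q} (hγ : Function.Surjective γ) {c : Q}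
    (h : IsMiddlePseudo γ c) : IsLeftPseudo γ c⁻¹ := by
  have ldiv_eq (a b : Q) : NLoop.ldiv a b = a⁻¹ * b := by
    rw [← lip a (NLoop.ldiv a b), NLoop.mul_ldiv]
  have rdiv_eq (a b : Q) : NLoop.rdiv b a = a⁻¹ * b := by
    rw [← lip a (NLoop.rdiv b a), comm a, NLoop.rdiv_mul]
  have autotopism (x y : Q) : γ (x * y) = (c * γ x) * (c⁻¹ * γ y) := by
    rw [h x y, rdiv_eq, ldiv_eq, ldiv_eq, NLoop.mul_one, NInvLoop.inv_inv_of_lip lip]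
  have map_one : γ 1 = 1 := by
    obtain ⟨y, hy⟩ := hγ c
    have k := autotopism 1 y
    rw [NLoop.one_mul, hy, NInvLoop.inv_mul, NLoop.mul_one] at k
    exact NInvLoop.mul_left_cancel_of_lip lip (k.symm.trans (NLoop.mul_one c).symm)
  have inv_eq (x : Q) : (c * γ x⁻¹)⁻¹ = c⁻¹ * γ x := by
    refine (NInvLoop.eq_inv_of_mul_eq_one lip ?_).symm
    rw [← autotopism, NInvLoop.inv_mul, map_one]
  intro x y
  have k := autotopism x⁻¹ (x * y)
  rw [lip] at k
  rw [k, ← inv_eq x, lip]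

end Pseudoautomorphisms

/-- Corollary: Every pseudoautomorphism (left, middle or right) of
a commutative inverse property loop is an automorphism. -/
theorem stmt_17 (Q : Type*) [NInvLoop Q]
    (comm : ∀ x y : Q, x * y = y * x)
    (lip : ∀ x y : Q, x⁻¹ * (x * y) = y)
    (rip : ∀ x y : Q, (y * x) * x⁻¹ = y) :
    (∀ (σ : Equiv.Perm Q) (a : Q), IsLeftPseudo (⇑σ) a → IsAutomorphism (⇑σ)) ∧
    (∀ (σ : Equiv.Perm Q) (c : Q), IsMiddlePseudo (⇑σ) c → IsAutomorphism (⇑σ)) ∧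
    (∀ (σ : Equiv.Perm Q) (b : Q), IsRightPseudo (⇑σ) b → IsAutomorphism (⇑σ)) := by
  exact ⟨fun σ _ h => h.isAutomorphism comm lip σ.surjective,
    fun σ _ h => (h.isLeftPseudo comm lip σ.surjective).isAutomorphism comm lip σ.surjective,
    fun σ _ h => (h.isLeftPseudo comm).isAutomorphism comm lip σ.surjective⟩
end
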